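/- arXiv:math/9807056 — 5 statements merged into one kernel-verified Lean document; each statement's English description precedes it below -/
import Mathlib

section
/- Let ω₁, ω₂ ∈ ℂ satisfy ω₁ ≠ ω₂, ω₁ ≠ 0, ω₂ ≠ 0 and ω₁ + ω₂ ≠ 0. Then the six entire functions of λ ∈ ℂ given by F₁(λ) = e^{ω₂λ} − e^{ω₁λ}, F₂(λ) = (ω₂ − ω₁)λ, F₃(λ) = λ(ω₂ e^{ω₂λ} − ω₁ e^{ω₁λ}), F₄(λ) = λ(ω₂ e^{ω₁λ} − ω₁ e^{ω₂λ}), F₅(λ) = (ω₂ − ω₁)λ e^{(ω₁+ω₂)λ}, F₆(λ) = ω₁ω₂λ²(e^{ω₂λ} − e^{ω₁λ}) are linearly independent over ℂ: if c₁, …, c₆ ∈ ℂ and c₁F₁(λ) + c₂F₂(λ) + c₃F₃(λ) + c₄F₄(λ) + c₅F₅(λ) + c₆F₆(λ) = 0 for all λ ∈ ℂ, then c₁ = c₂ = c₃ = c₄ = c₅ = c₆ = 0. -/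
open Complex

open Polynomial in
/-- The operator `P ↦ P' + c P`, which describes the derivative of `P(z) e^{c z}`, is injective
for `c ≠ 0`. -/
theorem Polynomial.eq_zero_of_derivative_add_C_mul_eq_zero {K : Type*} [Field K] {c : K}
    (hc : c ≠ 0) {P : K[X]} (hP : derivative P + C c * P = 0) : P = 0 := by
  by_contra h0
  have hlt : (derivative P).degree < (C c * P).degree := by
    rw [degree_C_mul hc]
    exact degree_derivative_lt h0
  rw [eq_neg_of_add_eq_zero_left hP, degree_neg] at hlt
  exact hlt.false

open Polynomial in
/-- Differentiating a vanishing exponential polynomial, twisted by `e^{b z}`. -/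
theorem exponentialPolynomial_derivative_eq_zero {ι : Type*} (s : Finset ι) (w : ι → ℂ) (b : ℂ)
    (P : ι → ℂ[X]) (h : ∀ z : ℂ, ∑ i ∈ s, (P i).eval z * exp (w i * z) = 0) (z : ℂ) :
    ∑ i ∈ s, (derivative (P i) + C (w i - b) * P i).eval z * exp (w i * z) = 0 := by
  have hd : HasDerivAt (fun z : ℂ => ∑ i ∈ s, (P i).eval z * exp (w i * z))
      (∑ i ∈ s, ((derivative (P i)).eval z * exp (w i * z) +
        (P i).eval z * (exp (w i * z) * (w i * 1)))) z :=
    HasDerivAt.fun_sum fun i _ =>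
      ((P i).hasDerivAt z).mul (((hasDerivAt_id z).const_mul (w i)).cexp)
  have hz := hd.unique ((hasDerivAt_const z (0 : ℂ)).congr_of_eventuallyEq (.of_forall h))
  calc
    _ = ∑ i ∈ s, ((derivative (P i)).eval z * exp (w i * z) +
          (P i).eval z * (exp (w i * z) * (w i * 1))) -
        b * ∑ i ∈ s, (P i).eval z * exp (w i * z) := by
      rw [Finset.mul_sum, ← Finset.sum_sub_distrib]
      refine Finset.sum_congr rfl fun i _ => ?_
      simp only [eval_add, eval_mul, eval_C]
      ring
    _ = 0 := by rw [hz, h z, mul_zero, sub_zero]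

open Polynomial in
/-- Exponentials with distinct frequencies are linearly independent over the polynomials. -/
theorem exponentialPolynomial_coeff_eq_zero {ι : Type*} (s : Finset ι) (w : ι → ℂ)
    (hw : Function.Injective w) (P : ι → ℂ[X])
    (h : ∀ z : ℂ, ∑ i ∈ s, (P i).eval z * exp (w i * z) = 0) : ∀ i ∈ s, P i = 0 := by
  classical
  induction s using Finset.induction_on generalizing P with
  | empty => simp
  | insert b s hb ih =>
    let T : ι → ℂ[X] → ℂ[X] := fun i Q => derivative Q + C (w i - w b) * Q
    have hT : ∀ (n : ℕ) (z : ℂ),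
        ∑ i ∈ insert b s, ((T i)^[n] (P i)).eval z * exp (w i * z) = 0 := by
      intro n
      induction n with
      | zero => exact h
      | succ n ihn =>
        simp only [Function.iterate_succ_apply']
        exact exponentialPolynomial_derivative_eq_zero _ w (w b) _ ihn
    have hTb : T b = derivative := by
      funext Q
      simp [T]
    have hs : ∀ i ∈ s, P i = 0 := by
      intro i hi
      have hiter := ih (fun i => (T i)^[(P b).natDegree + 1] (P i)) (fun z => by
        have hz := hT ((P b).natDegree + 1) z
        rwa [Finset.sum_insert hb, hTb,
          iterate_derivative_eq_zero (Nat.lt_succ_self _), eval_zero, zero_mul, zero_add] at hz)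
        i hi
      have hne : w i - w b ≠ 0 := sub_ne_zero.2 fun e => hb (hw e ▸ hi)
      have hinj : ∀ (n : ℕ) (Q : ℂ[X]), (T i)^[n] Q = 0 → Q = 0 := by
        intro n
        induction n with
        | zero => exact fun _ hQ => hQ
        | succ n ihn =>
          exact fun Q hQ => eq_zero_of_derivative_add_C_mul_eq_zero hne (ihn _ hQ)
      exact hinj _ _ hiter
    intro i hi
    rcases Finset.mem_insert.1 hi with rfl | hi
    · refine Polynomial.funext fun z => ?_
      have hz := h z
      rw [Finset.sum_insert hb, Finset.sum_eq_zero (fun j hj => by simp [hs j hj]), add_zero] at hz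
      simpa using hz
    · exact hs i hi

/-- The six entire functions
`e^{ω₂λ} − e^{ω₁λ}`, `(ω₂−ω₁)λ`, `λ(ω₂e^{ω₂λ} − ω₁e^{ω₁λ})`,
`λ(ω₂e^{ω₁λ} − ω₁e^{ω₂λ})`, `(ω₂−ω₁)λe^{(ω₁+ω₂)λ}` and
`ω₁ω₂λ²(e^{ω₂λ} − e^{ω₁λ})` are linearly independent over ℂ, provided
`ω₁ ≠ ω₂`, `ω₁ ≠ 0`, `ω₂ ≠ 0` and `ω₁ + ω₂ ≠ 0`. -/
theorem six_functions_linearIndependent (ω₁ ω₂ : ℂ)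
    (hne : ω₁ ≠ ω₂) (h1 : ω₁ ≠ 0) (h2 : ω₂ ≠ 0) (hsum : ω₁ + ω₂ ≠ 0)
    (c₁ c₂ c₃ c₄ c₅ c₆ : ℂ)
    (h : ∀ l : ℂ,
      c₁ * (exp (ω₂ * l) - exp (ω₁ * l)) +
      c₂ * ((ω₂ - ω₁) * l) +
      c₃ * (l * (ω₂ * exp (ω₂ * l) - ω₁ * exp (ω₁ * l))) +
      c₄ * (l * (ω₂ * exp (ω₁ * l) - ω₁ * exp (ω₂ * l))) +
      c₅ * ((ω₂ - ω₁) * l * exp ((ω₁ + ω₂) * l)) +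
      c₆ * (ω₁ * ω₂ * l ^ 2 * (exp (ω₂ * l) - exp (ω₁ * l))) = 0) :
    c₁ = 0 ∧ c₂ = 0 ∧ c₃ = 0 ∧ c₄ = 0 ∧ c₅ = 0 ∧ c₆ = 0 := by
  have hw : Function.Injective ![0, ω₁, ω₂, ω₁ + ω₂] := by
    intro i j hij
    fin_cases i <;> fin_cases j <;> simp_all [eq_comm]
  have key := exponentialPolynomial_coeff_eq_zero Finset.univ _ hw
    ![.C (c₂ * (ω₂ - ω₁)) * .X,
      .C (-c₁) + .C (c₄ * ω₂ - c₃ * ω₁) * .X + .C (-(c₆ * (ω₁ * ω₂))) * .X ^ 2,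
      .C c₁ + .C (c₃ * ω₂ - c₄ * ω₁) * .X + .C (c₆ * (ω₁ * ω₂)) * .X ^ 2,
      .C (c₅ * (ω₂ - ω₁)) * .X] (fun z => by
        refine Eq.trans ?_ (h z)
        simp [Fin.sum_univ_four]
        ring)
  have hsub : ω₂ - ω₁ ≠ 0 := sub_ne_zero.2 hne.symm
  have k0 := congrArg (Polynomial.coeff · 1) (key 0 (Finset.mem_univ _))
  have k1 := congrArg (Polynomial.coeff · 1) (key 1 (Finset.mem_univ _))
  have k20 := congrArg (Polynomial.coeff · 0) (key 2 (Finset.mem_univ _))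
  have k21 := congrArg (Polynomial.coeff · 1) (key 2 (Finset.mem_univ _))
  have k22 := congrArg (Polynomial.coeff · 2) (key 2 (Finset.mem_univ _))
  have k3 := congrArg (Polynomial.coeff · 1) (key 3 (Finset.mem_univ _))
  simp [-map_mul, -map_sub, -map_neg, Polynomial.coeff_X, Polynomial.coeff_C,
    Polynomial.coeff_X_pow] at k0 k1 k20 k21 k22 k3
  have hdet : (ω₂ - ω₁) * (ω₁ + ω₂) ≠ 0 := mul_ne_zero hsub hsum
  have e3 : c₃ = 0 := (mul_eq_zero.1 (by linear_combination ω₂ * k21 + ω₁ * k1 :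
    c₃ * ((ω₂ - ω₁) * (ω₁ + ω₂)) = 0)).resolve_right hdet
  have e4 : c₄ = 0 := (mul_eq_zero.1 (by linear_combination ω₁ * k21 + ω₂ * k1 :
    c₄ * ((ω₂ - ω₁) * (ω₁ + ω₂)) = 0)).resolve_right hdet
  refine ⟨k20, ?_, e3, e4, ?_, ?_⟩ <;> simp_all
end

section
/- Let A and Ã be complex 2×4 matrices such that for every pair of columns 1 ≤ p < q ≤ 4 the corresponding 2×2 minors agree: a_{1p} a_{2q} − a_{1q} a_{2p} = ã_{1p} ã_{2q} − ã_{1q} ã_{2p}. Then the 4×4 matrix obtained by stacking A on top of Ã has rank at most 2; in particular, every 3×3 minor of this stacked matrix vanishes. -/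
namespace Matrix

variable {K n : Type*} [Field K]

/-- A two-row matrix whose `2 × 2` minors all vanish is an outer product. -/
theorem exists_eq_vecMulVec_of_minors_eq_zero (A : Matrix (Fin 2) n K)
    (h : ∀ p q, A 0 p * A 1 q - A 0 q * A 1 p = 0) :
    ∃ (u : Fin 2 → K) (v : n → K), A = vecMulVec u v := by
  by_cases hA : A = 0
  · exact ⟨0, 0, by simp [hA]⟩
  · obtain ⟨i, p, hip⟩ : ∃ i p, A i p ≠ 0 := by
      by_contra! hzero
      exact hA (ext hzero)
    refine ⟨fun j => A j p / A i p, A i, ?_⟩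
    ext j q
    rw [vecMulVec_apply, div_mul_eq_mul_div, eq_div_iff hip]
    fin_cases i <;> fin_cases j <;> simp only [Fin.zero_eta, Fin.mk_one]
    · ring
    · linear_combination h p q
    · linear_combination -h p q
    · ring

/-- Two-row matrices with the same `2 × 2` minors have their rows in a common span of two
vectors. -/
theorem exists_common_right_factor_of_minors_eq (A B : Matrix (Fin 2) n K)
    (h : ∀ p q, A 0 p * A 1 q - A 0 q * A 1 p = B 0 p * B 1 q - B 0 q * B 1 p) :
    ∃ (U W : Matrix (Fin 2) (Fin 2) K) (V : Matrix (Fin 2) n K), A = U * V ∧ B = W * V := by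
  by_cases hzero : ∀ p q, A 0 p * A 1 q - A 0 q * A 1 p = 0
  · obtain ⟨u, v, hA⟩ := exists_eq_vecMulVec_of_minors_eq_zero A hzero
    obtain ⟨w, x, hB⟩ := exists_eq_vecMulVec_of_minors_eq_zero B fun p q => h p q ▸ hzero p q
    refine ⟨of fun i => ![u i, 0], of fun i => ![0, w i], of ![v, x], ?_, ?_⟩
    · ext i j
      simp [hA, mul_apply, vecMulVec_apply]
    · ext i j
      simp [hB, mul_apply, vecMulVec_apply]
  · push Not at hzero
    obtain ⟨p, q, hpq⟩ := hzero
    set d := A 0 p * A 1 q - A 0 q * A 1 p with hd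
    refine ⟨1, of fun i => ![(B i p * A 1 q - B i q * A 1 p) / d,
      (B i q * A 0 p - B i p * A 0 q) / d], A, by simp, ?_⟩
    ext i k
    simp only [mul_apply, Fin.sum_univ_two, of_apply, cons_val_zero, cons_val_one]
    rw [div_mul_eq_mul_div, div_mul_eq_mul_div, ← add_div, eq_div_iff hpq, hd]
    fin_cases i <;> simp only [Fin.zero_eta, Fin.mk_one]
    · linear_combination B 0 k * h p q - B 0 q * h p k + B 0 p * h q k
    · linear_combination B 1 k * h p q - B 1 q * h p k + B 1 p * h q k

/-- A square matrix which factors through a smaller index type has zero determinant. -/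
theorem det_mul_eq_zero_of_card_lt {l m : Type*} [Fintype l] [Fintype m] [DecidableEq l]
    (U : Matrix l m K) (V : Matrix m l K) (hcard : Fintype.card m < Fintype.card l) :
    (U * V).det = 0 := by
  by_contra hdet
  have hrank := rank_of_isUnit (U * V) ((isUnit_iff_isUnit_det _).2 (isUnit_iff_ne_zero.2 hdet))
  have hle := (rank_mul_le_left U V).trans (rank_le_card_width U)
  omega

end Matrix

/-- If two 2×4 complex matrices have equal 2×2 minors on every pair of
columns, then the 4×4 matrix obtained by stacking them (rows 0,1 from `A`,
rows 2,3 from `B`) has rank at most 2; in particular every 3×3 minor of the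
stacked matrix vanishes. -/
theorem stacked_rank_le_two_of_minors_eq (A B : Matrix (Fin 2) (Fin 4) ℂ)
    (hminors : ∀ p q : Fin 4, p < q →
      A 0 p * A 1 q - A 0 q * A 1 p = B 0 p * B 1 q - B 0 q * B 1 p)
    (S : Matrix (Fin 4) (Fin 4) ℂ)
    (hS : S = (Matrix.fromRows A B).submatrix
      (finSumFinEquiv (m := 2) (n := 2)).symm id) :
    S.rank ≤ 2 ∧
      ∀ (r c : Fin 3 → Fin 4), Function.Injective r → Function.Injective c →
        (S.submatrix r c).det = 0 := by
  have h : ∀ p q, A 0 p * A 1 q - A 0 q * A 1 p = B 0 p * B 1 q - B 0 q * B 1 p := by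
    intro p q
    rcases lt_trichotomy p q with hpq | rfl | hpq
    · exact hminors p q hpq
    · ring
    · linear_combination -hminors q p hpq
  obtain ⟨U, W, V, hA, hB⟩ := Matrix.exists_common_right_factor_of_minors_eq A B h
  set L := (Matrix.fromRows U W).submatrix (finSumFinEquiv (m := 2) (n := 2)).symm id
  have hLV : S = L * V := by
    rw [hS, hA, hB, ← Matrix.fromRows_mul]
    rfl
  constructor
  · rw [hLV]
    exact (Matrix.rank_mul_le_left L V).trans (Matrix.rank_le_width L)
  · intro r c _ _
    rw [hLV, Matrix.submatrix_mul L V r id c Function.bijective_id]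
    exact Matrix.det_mul_eq_zero_of_card_lt _ _ (by simp)
end

section
/- Consider the two boundary-value problems for the same equation y''(x) − λ² y(x) = 0 on [0,1]: problem A with boundary conditions y(0) + 2y'(0) = 0 and y(1) = 0, and problem B with boundary conditions y(0) = 0 and y(1) − 2y'(1) = 0. Then: (i) for every λ ∈ ℂ, λ is an eigenvalue of problem A if and only if λ is an eigenvalue of problem B; and (ii) the span in ℂ⁴ of the boundary coefficient vectors of problem A, namely {(1,0,2,0), (0,1,0,0)}, is different from the span of the boundary coefficient vectors of problem B, namely {(1,0,0,0), (0,1,0,−2)}. (This shows the condition b ≠ 0 in the uniqueness theorem is essential: here b = 0, c = −1, b² − 4c ≠ 0, c ≠ 0.) -/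
/-- `λ` is an eigenvalue of problem A: `y'' − λ²y = 0` on `[0,1]`,
`y(0) + 2y'(0) = 0`, `y(1) = 0`. -/
def IsEigA10 (l : ℂ) : Prop :=
  ∃ y : ℝ → ℂ, Differentiable ℝ y ∧ Differentiable ℝ (deriv y) ∧
    (∀ x ∈ Set.Icc (0 : ℝ) 1, deriv (deriv y) x - l ^ 2 * y x = 0) ∧
    (∃ x ∈ Set.Icc (0 : ℝ) 1, y x ≠ 0) ∧
    y 0 + 2 * deriv y 0 = 0 ∧ y 1 = 0

/-- `λ` is an eigenvalue of problem B: `y'' − λ²y = 0` on `[0,1]`,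
`y(0) = 0`, `y(1) − 2y'(1) = 0`. -/
def IsEigB10 (l : ℂ) : Prop :=
  ∃ y : ℝ → ℂ, Differentiable ℝ y ∧ Differentiable ℝ (deriv y) ∧
    (∀ x ∈ Set.Icc (0 : ℝ) 1, deriv (deriv y) x - l ^ 2 * y x = 0) ∧
    (∃ x ∈ Set.Icc (0 : ℝ) 1, y x ≠ 0) ∧
    y 0 = 0 ∧ y 1 - 2 * deriv y 1 = 0

/-- Reflection `x ↦ 1 - x` preserves the nontrivial solutions of `y'' - λ²y = 0` on `[0,1]`. -/
theorem reflect_solution {l : ℂ} {y : ℝ → ℂ} (hy : Differentiable ℝ y)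
    (hy' : Differentiable ℝ (deriv y))
    (hode : ∀ x ∈ Set.Icc (0 : ℝ) 1, deriv (deriv y) x - l ^ 2 * y x = 0)
    (hne : ∃ x ∈ Set.Icc (0 : ℝ) 1, y x ≠ 0) :
    Differentiable ℝ (fun x => y (1 - x)) ∧
      Differentiable ℝ (deriv fun x => y (1 - x)) ∧
      (∀ x ∈ Set.Icc (0 : ℝ) 1,
        deriv (deriv fun x => y (1 - x)) x - l ^ 2 * y (1 - x) = 0) ∧
      ∃ x ∈ Set.Icc (0 : ℝ) 1, y (1 - x) ≠ 0 := by
  have hderiv : (deriv fun x => y (1 - x)) = fun x => -deriv y (1 - x) :=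
    funext (deriv_comp_const_sub y 1)
  refine ⟨by fun_prop, ?_, fun x hx => ?_, ?_⟩
  · rw [hderiv]
    fun_prop
  · rw [hderiv, deriv.fun_neg, deriv_comp_const_sub, neg_neg]
    exact hode _ ⟨by linarith [hx.2], by linarith [hx.1]⟩
  · obtain ⟨x, hx, hyx⟩ := hne
    exact ⟨1 - x, ⟨by linarith [hx.2], by linarith [hx.1]⟩, by simpa using hyx⟩

theorem isEigA10_iff_isEigB10 (l : ℂ) : IsEigA10 l ↔ IsEigB10 l := by
  constructor
  · rintro ⟨y, hy, hy', hode, hne, h0, h1⟩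
    obtain ⟨hz, hz', hzode, hzne⟩ := reflect_solution hy hy' hode hne
    refine ⟨_, hz, hz', hzode, hzne, by simpa using h1, ?_⟩
    rw [deriv_comp_const_sub]
    simpa using h0
  · rintro ⟨y, hy, hy', hode, hne, h0, h1⟩
    obtain ⟨hz, hz', hzode, hzne⟩ := reflect_solution hy hy' hode hne
    refine ⟨_, hz, hz', hzode, hzne, ?_, by simpa using h0⟩
    rw [deriv_comp_const_sub]
    simpa [sub_eq_add_neg] using h1

/-- Problems A and B have the same eigenvalues, yet the spans of their
boundary coefficient vectors in ℂ⁴ are different: the condition `b ≠ 0` in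
the uniqueness theorem is essential. -/
theorem same_spectrum_different_boundary_forms :
    (∀ l : ℂ, IsEigA10 l ↔ IsEigB10 l) ∧
      Submodule.span ℂ ({![1, 0, 2, 0], ![0, 1, 0, 0]} : Set (Fin 4 → ℂ)) ≠
        Submodule.span ℂ ({![1, 0, 0, 0], ![0, 1, 0, -2]} : Set (Fin 4 → ℂ)) := by
  refine ⟨isEigA10_iff_isEigB10, fun h => ?_⟩
  have hmem : (![0, 1, 0, 0] : Fin 4 → ℂ) ∈
      Submodule.span ℂ ({![1, 0, 0, 0], ![0, 1, 0, -2]} : Set (Fin 4 → ℂ)) :=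
    h ▸ Submodule.subset_span (by simp)
  obtain ⟨a, b, hab⟩ := Submodule.mem_span_pair.mp hmem
  have hb : b = 1 := by simpa using congrFun hab 1
  have hb' : b = 0 := by simpa using congrFun hab 3
  exact one_ne_zero (hb.symm.trans hb')
end

section
/- Consider the two boundary-value problems for the equation y''(x) − 3λ y'(x) + 2λ² y(x) = 0 on [0,1] with λ-dependent boundary conditions: problem A with λ y(0) + y'(0) = 0 and 4λ y(1) + y'(1) = 0, and problem B with λ y(0) + 2y'(0) = 0 and 2λ y(1) + y'(1) = 0. Then: (i) for every λ ∈ ℂ, λ is an eigenvalue of problem A if and only if λ is an eigenvalue of problem B, and this holds exactly when λ = 0 or e^{λ} = 5/4 (equivalently, the nonzero eigenvalues of both problems are the nonzero roots of the characteristic determinant λ²(12 e^{2λ} − 15 e^{λ})); and (ii) for every λ ≠ 0, the span in ℂ⁴ of the boundary coefficient vectors {(λ,0,1,0), (0,4λ,0,1)} of problem A is different from the span of the vectors {(λ,0,2,0), (0,2λ,0,1)} of problem B. Hence boundary conditions whose coefficients depend on the spectral parameter λ are not uniquely determined by the spectrum. -/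
open Complex

/-- `λ` is an eigenvalue of problem A: `y'' − 3λy' + 2λ²y = 0` on `[0,1]`
with λ-dependent boundary conditions `λy(0) + y'(0) = 0`,
`4λy(1) + y'(1) = 0`. -/
def IsEigA11 (l : ℂ) : Prop :=
  ∃ y : ℝ → ℂ, Differentiable ℝ y ∧ Differentiable ℝ (deriv y) ∧
    (∀ x ∈ Set.Icc (0 : ℝ) 1,
      deriv (deriv y) x - 3 * l * deriv y x + 2 * l ^ 2 * y x = 0) ∧
    (∃ x ∈ Set.Icc (0 : ℝ) 1, y x ≠ 0) ∧
    l * y 0 + deriv y 0 = 0 ∧ 4 * l * y 1 + deriv y 1 = 0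

/-- `λ` is an eigenvalue of problem B: `y'' − 3λy' + 2λ²y = 0` on `[0,1]`
with λ-dependent boundary conditions `λy(0) + 2y'(0) = 0`,
`2λy(1) + y'(1) = 0`. -/
def IsEigB11 (l : ℂ) : Prop :=
  ∃ y : ℝ → ℂ, Differentiable ℝ y ∧ Differentiable ℝ (deriv y) ∧
    (∀ x ∈ Set.Icc (0 : ℝ) 1,
      deriv (deriv y) x - 3 * l * deriv y x + 2 * l ^ 2 * y x = 0) ∧
    (∃ x ∈ Set.Icc (0 : ℝ) 1, y x ≠ 0) ∧
    l * y 0 + 2 * deriv y 0 = 0 ∧ 2 * l * y 1 + deriv y 1 = 0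

/-- A solution of `w' = k w` on `[0, 1]` is a multiple of the exponential. -/
theorem eq_mul_exp_of_deriv_eq_mul {k : ℂ} {w : ℝ → ℂ} (hw : Differentiable ℝ w)
    (h : ∀ x ∈ Set.Icc (0 : ℝ) 1, deriv w x = k * w x) :
    ∀ x ∈ Set.Icc (0 : ℝ) 1, w x = w 0 * exp (k * x) := by
  have hd (x : ℝ) : HasDerivAt (fun t : ℝ ↦ w t * exp (-k * t))
      (deriv w x * exp (-k * x) + w x * (exp (-k * x) * (-k * 1))) x :=
    (hw x).hasDerivAt.mul (((hasDerivAt_id x).ofReal_comp.const_mul (-k)).cexp)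
  intro x hx
  have hconst := constant_of_has_deriv_right_zero (f := fun t : ℝ ↦ w t * exp (-k * t))
    (fun x _ ↦ (hd x).continuousAt.continuousWithinAt)
    (fun x hx ↦ ((hd x).congr_deriv (by
      rw [h x (Set.Ico_subset_Icc_self hx)]; ring)).hasDerivWithinAt) x hx
  simp only [ofReal_zero, mul_zero, exp_zero, mul_one] at hconst
  rw [← hconst, mul_assoc, ← exp_add]
  simp

/-- The general solution of `y'' - 3 l y' + 2 l² y = 0` on `[0, 1]` for `l ≠ 0`. -/
theorem exists_eq_exp_add_exp {l : ℂ} (hl : l ≠ 0) {y : ℝ → ℂ} (hy : Differentiable ℝ y)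
    (hy' : Differentiable ℝ (deriv y))
    (h : ∀ x ∈ Set.Icc (0 : ℝ) 1,
      deriv (deriv y) x - 3 * l * deriv y x + 2 * l ^ 2 * y x = 0) :
    ∃ α β : ℂ, ∀ x ∈ Set.Icc (0 : ℝ) 1,
      y x = α * exp (l * x) + β * exp (2 * l * x) ∧
      deriv y x = l * (α * exp (l * x) + 2 * β * exp (2 * l * x)) := by
  have factor (m k : ℂ) (hsum : m + k = 3 * l) (hprod : m * k = 2 * l ^ 2) :
      ∀ x ∈ Set.Icc (0 : ℝ) 1,
        deriv y x - m * y x = (deriv y 0 - m * y 0) * exp (k * x) := by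
    refine eq_mul_exp_of_deriv_eq_mul (w := fun x ↦ deriv y x - m * y x)
      (hy'.sub (hy.const_mul m)) fun x hx ↦ ?_
    refine ((hy' x).hasDerivAt.sub ((hy x).hasDerivAt.const_mul m)).deriv.trans ?_
    linear_combination h x hx - deriv y x * hsum + y x * hprod
  refine ⟨-(deriv y 0 - 2 * l * y 0) / l, (deriv y 0 - l * y 0) / l, fun x hx ↦ ?_⟩
  have hu := factor (2 * l) l (by ring) (by ring) x hx
  have hv := factor l (2 * l) (by ring) (by ring) x hx
  generalize exp (l * x) = E at hu ⊢
  generalize exp (2 * l * x) = F at hv ⊢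
  constructor
  · field_simp
    linear_combination hv - hu
  · field_simp
    linear_combination 2 * hv - hu

theorem hasDerivAt_exp_add_exp (l α β : ℂ) (x : ℝ) :
    HasDerivAt (fun t : ℝ ↦ α * exp (l * t) + β * exp (2 * l * t))
      (l * α * exp (l * x) + 2 * l * β * exp (2 * l * x)) x := by
  have key (k : ℂ) : HasDerivAt (fun t : ℝ ↦ exp (k * t)) (exp (k * x) * (k * 1)) x :=
    ((hasDerivAt_id x).ofReal_comp.const_mul k).cexp
  exact (((key l).const_mul α).add ((key (2 * l)).const_mul β)).congr_deriv (by ring)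

/-- Eigenvalues of `y'' - 3 l y' + 2 l² y = 0` under separated boundary conditions
`c₁ l y(0) + c₂ y'(0) = 0` and `d₁ l y(1) + d₂ y'(1) = 0`. -/
theorem exists_eigenfunction_iff {c₁ c₂ d₁ d₂ : ℂ} (hc : c₂ ≠ 0) (l : ℂ) :
    (∃ y : ℝ → ℂ, Differentiable ℝ y ∧ Differentiable ℝ (deriv y) ∧
      (∀ x ∈ Set.Icc (0 : ℝ) 1,
        deriv (deriv y) x - 3 * l * deriv y x + 2 * l ^ 2 * y x = 0) ∧
      (∃ x ∈ Set.Icc (0 : ℝ) 1, y x ≠ 0) ∧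
      c₁ * l * y 0 + c₂ * deriv y 0 = 0 ∧ d₁ * l * y 1 + d₂ * deriv y 1 = 0) ↔
    l = 0 ∨ (c₁ + c₂) * (d₁ + 2 * d₂) * exp l = (c₁ + 2 * c₂) * (d₁ + d₂) := by
  have exp_two_mul : exp (2 * l) = exp l * exp l := by rw [two_mul, exp_add]
  constructor
  · rintro ⟨y, hy, hy', hode, ⟨x, hx, hyx⟩, h0, h1⟩
    refine or_iff_not_imp_left.2 fun hl ↦ ?_
    obtain ⟨α, β, hsol⟩ := exists_eq_exp_add_exp hl hy hy' hode
    rw [(hsol 0 (by simp)).1, (hsol 0 (by simp)).2] at h0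
    rw [(hsol 1 (by simp)).1, (hsol 1 (by simp)).2] at h1
    simp only [ofReal_zero, ofReal_one, mul_zero, mul_one, exp_zero, exp_two_mul] at h0 h1
    have e0 : (c₁ + c₂) * α + (c₁ + 2 * c₂) * β = 0 :=
      mul_left_cancel₀ hl (by linear_combination h0)
    have e1 : (d₁ + d₂) * α + (d₁ + 2 * d₂) * exp l * β = 0 :=
      mul_left_cancel₀ (mul_ne_zero hl (exp_ne_zero l)) (by linear_combination h1)
    by_contra hdet
    have hdet' := sub_ne_zero.2 hdet
    have hα : α = 0 := mul_left_cancel₀ hdet'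
      (by linear_combination (d₁ + 2 * d₂) * exp l * e0 - (c₁ + 2 * c₂) * e1)
    have hβ : β = 0 := mul_left_cancel₀ hdet'
      (by linear_combination (c₁ + c₂) * e1 - (d₁ + d₂) * e0)
    exact hyx (by simp [(hsol x hx).1, hα, hβ])
  · rintro (rfl | hdet)
    · exact ⟨fun _ ↦ 1, by simp, by simp, by simp, ⟨0, by simp⟩, by simp, by simp⟩
    · have hd (α β : ℂ) : deriv (fun t : ℝ ↦ α * exp (l * t) + β * exp (2 * l * t)) =
          fun t : ℝ ↦ l * α * exp (l * t) + 2 * l * β * exp (2 * l * t) :=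
        funext fun x ↦ (hasDerivAt_exp_add_exp l α β x).deriv
      refine ⟨fun t ↦ -(c₁ + 2 * c₂) * exp (l * t) + (c₁ + c₂) * exp (2 * l * t),
        fun x ↦ (hasDerivAt_exp_add_exp l _ _ x).differentiableAt, ?_, fun x _ ↦ ?_,
        ⟨0, by simp, ?_⟩, ?_, ?_⟩
      · rw [hd]
        exact fun x ↦ (hasDerivAt_exp_add_exp l _ _ x).differentiableAt
      · simp only [hd]
        ring
      · simp only [ofReal_zero, mul_zero, exp_zero]
        exact fun h ↦ hc (by linear_combination -h)
      · simp only [hd, ofReal_zero, mul_zero, exp_zero]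
        ring
      · simp only [hd, ofReal_one, mul_one, exp_two_mul]
        linear_combination l * exp l * hdet

theorem isEigA11_iff (l : ℂ) : IsEigA11 l ↔ l = 0 ∨ exp l = 5 / 4 := by
  have h := exists_eigenfunction_iff (c₁ := 1) (c₂ := 1) (d₁ := 4) (d₂ := 1) one_ne_zero l
  simp only [one_mul] at h
  refine h.trans (or_congr_right ⟨fun h ↦ ?_, fun h ↦ ?_⟩)
  · linear_combination h / 12
  · linear_combination 12 * h

theorem isEigB11_iff (l : ℂ) : IsEigB11 l ↔ l = 0 ∨ exp l = 5 / 4 := by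
  have h := exists_eigenfunction_iff (c₁ := 1) (c₂ := 2) (d₁ := 2) (d₂ := 1) two_ne_zero l
  simp only [one_mul] at h
  refine h.trans (or_congr_right ⟨fun h ↦ ?_, fun h ↦ ?_⟩)
  · linear_combination h / 12
  · linear_combination 12 * h

/-- Problems A and B (with λ-dependent boundary conditions) have the same
eigenvalues — namely `λ = 0` together with the roots of `e^λ = 5/4`, i.e. the
nonzero roots of `λ²(12e^{2λ} − 15e^{λ})` — yet for every `λ ≠ 0` the spans of
their boundary coefficient vectors in ℂ⁴ differ: λ-dependent boundary
conditions are not determined by the spectrum. -/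
theorem lambda_dependent_boundary_conditions_not_determined :
    (∀ l : ℂ,
        (IsEigA11 l ↔ IsEigB11 l) ∧
        (IsEigA11 l ↔ (l = 0 ∨ exp l = 5 / 4)) ∧
        (l ≠ 0 → (IsEigA11 l ↔ l ^ 2 * (12 * exp (2 * l) - 15 * exp l) = 0))) ∧
      ∀ l : ℂ, l ≠ 0 →
        Submodule.span ℂ ({![l, 0, 1, 0], ![0, 4 * l, 0, 1]} : Set (Fin 4 → ℂ)) ≠
          Submodule.span ℂ ({![l, 0, 2, 0], ![0, 2 * l, 0, 1]} : Set (Fin 4 → ℂ)) := by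
  refine ⟨fun l ↦ ⟨(isEigA11_iff l).trans (isEigB11_iff l).symm, isEigA11_iff l,
    fun hl ↦ ?_⟩, fun l hl hspan ↦ ?_⟩
  · have hfactor : l ^ 2 * (12 * exp (2 * l) - 15 * exp l) =
        12 * l ^ 2 * exp l * (exp l - 5 / 4) := by
      rw [two_mul, exp_add]
      ring
    rw [isEigA11_iff, hfactor]
    simp [hl, exp_ne_zero, sub_eq_zero]
  · have hmem : ![l, 0, 1, 0] ∈
        Submodule.span ℂ ({![l, 0, 2, 0], ![0, 2 * l, 0, 1]} : Set (Fin 4 → ℂ)) :=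
      hspan ▸ Submodule.subset_span (by simp)
    obtain ⟨a, b, hab⟩ := Submodule.mem_span_pair.1 hmem
    have h0 : a * l = l := by simpa using congrFun hab 0
    have h2 : a * 2 = 1 := by simpa using congrFun hab 2
    exact hl (by linear_combination l * h2 - 2 * h0)
end

section
/- Consider the two boundary-value problems on [0, π], both with Dirichlet boundary conditions y(0) = 0 and y(π) = 0: problem A for the equation y''(x) + 2λ y'(x) + 2λ² y(x) = 0 and problem B for the equation y''(x) + 4λ y'(x) + 5λ² y(x) = 0. Then the two problems have exactly the same eigenvalues: for every λ ∈ ℂ, λ is an eigenvalue of problem A if and only if λ is an eigenvalue of problem B, and this holds exactly when λ is a nonzero integer. The boundary conditions of the two problems coincide, yet the equation coefficients differ ((b,c) = (2,2) versus (4,5)). Hence one cannot simultaneously recover both the equation coefficients and the boundary condition coefficients from the spectrum. -/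
/-- `λ` is an eigenvalue of problem A: `y'' + 2λy' + 2λ²y = 0` on `[0, π]`
with Dirichlet conditions `y(0) = 0`, `y(π) = 0`. -/
def IsEigA13 (l : ℂ) : Prop :=
  ∃ y : ℝ → ℂ, Differentiable ℝ y ∧ Differentiable ℝ (deriv y) ∧
    (∀ x ∈ Set.Icc (0 : ℝ) Real.pi,
      deriv (deriv y) x + 2 * l * deriv y x + 2 * l ^ 2 * y x = 0) ∧
    (∃ x ∈ Set.Icc (0 : ℝ) Real.pi, y x ≠ 0) ∧
    y 0 = 0 ∧ y Real.pi = 0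

/-- `λ` is an eigenvalue of problem B: `y'' + 4λy' + 5λ²y = 0` on `[0, π]`
with Dirichlet conditions `y(0) = 0`, `y(π) = 0`. -/
def IsEigB13 (l : ℂ) : Prop :=
  ∃ y : ℝ → ℂ, Differentiable ℝ y ∧ Differentiable ℝ (deriv y) ∧
    (∀ x ∈ Set.Icc (0 : ℝ) Real.pi,
      deriv (deriv y) x + 4 * l * deriv y x + 5 * l ^ 2 * y x = 0) ∧
    (∃ x ∈ Set.Icc (0 : ℝ) Real.pi, y x ≠ 0) ∧
    y 0 = 0 ∧ y Real.pi = 0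

open Complex in
lemma hasDerivAt_cexp_mul_ofReal (a : ℂ) (x : ℝ) :
    HasDerivAt (fun t : ℝ => exp (a * t)) (a * exp (a * x)) x := by
  simpa [mul_comm] using ((hasDerivAt_id (x : ℂ)).const_mul a).cexp.comp_ofReal

open Complex in
lemma hasDerivAt_csin_mul_ofReal (a : ℂ) (x : ℝ) :
    HasDerivAt (fun t : ℝ => sin (a * t)) (a * cos (a * x)) x := by
  simpa [mul_comm] using ((hasDerivAt_id (x : ℂ)).const_mul a).csin.comp_ofReal

open Complex in
lemma hasDerivAt_ccos_mul_ofReal (a : ℂ) (x : ℝ) :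
    HasDerivAt (fun t : ℝ => cos (a * t)) (-(a * sin (a * x))) x := by
  simpa [mul_comm] using ((hasDerivAt_id (x : ℂ)).const_mul a).ccos.comp_ofReal

open Complex in
/-- Solutions of `z'' + l²z = 0` with `z(0) = 0` satisfy `l z(x) = z'(0) sin(lx)`
and `z'(x) = z'(0) cos(lx)`. -/
lemma harmonic_dirichlet_eq {l : ℂ} {b : ℝ} {z w u : ℝ → ℂ}
    (hz : ∀ x, HasDerivAt z (w x) x) (hw : ∀ x, HasDerivAt w (u x) x)
    (hu : ∀ x ∈ Set.Icc 0 b, u x = -l ^ 2 * z x) (h0 : z 0 = 0) :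
    ∀ x ∈ Set.Icc 0 b, l * z x = w 0 * sin (l * x) ∧ w x = w 0 * cos (l * x) := by
  have hP (x : ℝ) : HasDerivAt
      (fun t : ℝ => l * z t * cos (l * t) - w t * sin (l * t))
      (-sin (l * x) * (u x + l ^ 2 * z x)) x := by
    refine HasDerivAt.congr_deriv
      ((((hz x).const_mul l).fun_mul (hasDerivAt_ccos_mul_ofReal l x)).fun_sub
      ((hw x).fun_mul (hasDerivAt_csin_mul_ofReal l x))) ?_
    ring
  have hQ (x : ℝ) : HasDerivAt
      (fun t : ℝ => l * z t * sin (l * t) + w t * cos (l * t))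
      (cos (l * x) * (u x + l ^ 2 * z x)) x := by
    refine HasDerivAt.congr_deriv
      ((((hz x).const_mul l).fun_mul (hasDerivAt_csin_mul_ofReal l x)).fun_add
      ((hw x).fun_mul (hasDerivAt_ccos_mul_ofReal l x))) ?_
    ring
  have hP0 := constant_of_has_deriv_right_zero
    (fun x _ => (hP x).continuousAt.continuousWithinAt) (a := 0) (b := b) fun x hx => by
      simpa [hu x (Set.Ico_subset_Icc_self hx)] using (hP x).hasDerivWithinAt (s := Set.Ici x)
  have hQ0 := constant_of_has_deriv_right_zero
    (fun x _ => (hQ x).continuousAt.continuousWithinAt) (a := 0) (b := b) fun x hx => by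
      simpa [hu x (Set.Ico_subset_Icc_self hx)] using (hQ x).hasDerivWithinAt (s := Set.Ici x)
  intro x hx
  have h1 := hP0 x hx
  have h2 := hQ0 x hx
  simp only [h0, ofReal_zero, mul_zero, sin_zero, cos_zero, mul_one, sub_zero,
    zero_add] at h1 h2
  have h3 := sin_sq_add_cos_sq (l * x)
  constructor
  · linear_combination cos (l * x) * h1 + sin (l * x) * h2 - l * z x * h3
  · linear_combination cos (l * x) * h2 - sin (l * x) * h1 - w x * h3

open Complex in
/-- A nontrivial solution of `z'' + l²z = 0` on `[0, π]` vanishing at both ends forces `l` to be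
a nonzero integer. -/
lemma harmonic_dirichlet_eigenvalue {l : ℂ} {z w u : ℝ → ℂ}
    (hz : ∀ x, HasDerivAt z (w x) x) (hw : ∀ x, HasDerivAt w (u x) x)
    (hu : ∀ x ∈ Set.Icc 0 Real.pi, u x = -l ^ 2 * z x) (h0 : z 0 = 0) (hpi : z Real.pi = 0)
    (hne : ∃ x ∈ Set.Icc 0 Real.pi, z x ≠ 0) :
    ∃ n : ℤ, n ≠ 0 ∧ l = (n : ℂ) := by
  have key := harmonic_dirichlet_eq hz hw hu h0
  have hπ : Real.pi ∈ Set.Icc 0 Real.pi := Set.right_mem_Icc.2 Real.pi_pos.le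
  have hπ0 : (Real.pi : ℂ) ≠ 0 := by exact_mod_cast Real.pi_ne_zero
  obtain ⟨c, hc, hzc⟩ := hne
  rcases eq_or_ne l 0 with rfl | hl
  · exfalso
    have hR (x : ℝ) : HasDerivAt (fun t : ℝ => z t - w 0 * (t : ℂ)) (w x - w 0) x := by
      simpa using (hz x).fun_sub ((hasDerivAt_id x).ofReal_comp.const_mul (w 0))
    have hR0 := constant_of_has_deriv_right_zero
      (fun x _ => (hR x).continuousAt.continuousWithinAt) (a := 0) (b := Real.pi) fun x hx => by
        have hwx : w x = w 0 := by simpa using (key x (Set.Ico_subset_Icc_self hx)).2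
        simpa [hwx] using (hR x).hasDerivWithinAt (s := Set.Ici x)
    have h1 : w 0 = 0 := by simpa [h0, hpi, hπ0] using hR0 Real.pi hπ
    exact hzc (by simpa [h0, h1] using hR0 c hc)
  · have hw0 : w 0 ≠ 0 := fun h => hzc (by simpa [h, hl] using (key c hc).1)
    have hs : sin (l * Real.pi) = 0 := by simpa [hpi, hw0] using (key Real.pi hπ).1
    obtain ⟨n, hn⟩ := sin_eq_zero_iff.1 hs
    have hln : l = n := mul_right_cancel₀ hπ0 hn
    exact ⟨n, fun h => hl (by simp [hln, h]), hln⟩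

open Complex in
/-- The Dirichlet eigenvalues on `[0, π]` of `y'' + 2kλy' + (k² + 1)λ²y = 0`, whose characteristic
roots are `-k ± i`, are the nonzero integers. -/
lemma dirichlet_eigenvalue_iff (k l : ℂ) :
    (∃ y : ℝ → ℂ, Differentiable ℝ y ∧ Differentiable ℝ (deriv y) ∧
      (∀ x ∈ Set.Icc (0 : ℝ) Real.pi,
        deriv (deriv y) x + 2 * k * l * deriv y x + (k ^ 2 + 1) * l ^ 2 * y x = 0) ∧
      (∃ x ∈ Set.Icc (0 : ℝ) Real.pi, y x ≠ 0) ∧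
      y 0 = 0 ∧ y Real.pi = 0) ↔ ∃ n : ℤ, n ≠ 0 ∧ l = (n : ℂ) := by
  constructor
  · rintro ⟨y, hy, hy', hode, ⟨c, hc, hyc⟩, h0, hpi⟩
    have hE (x : ℝ) := hasDerivAt_cexp_mul_ofReal (k * l) x
    refine harmonic_dirichlet_eigenvalue
      (z := fun t => exp (k * l * t) * y t)
      (w := fun t => exp (k * l * t) * (deriv y t + k * l * y t))
      (u := fun t => exp (k * l * t) *
        (deriv (deriv y) t + 2 * k * l * deriv y t + k ^ 2 * l ^ 2 * y t))
      (fun x => ?_) (fun x => ?_) (fun x hx => ?_) (by simp [h0]) (by simp [hpi])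
      ⟨c, hc, by simp [exp_ne_zero, hyc]⟩
    · refine HasDerivAt.congr_deriv ((hE x).fun_mul (hy x).hasDerivAt) ?_
      ring
    · refine HasDerivAt.congr_deriv ((hE x).fun_mul
        ((hy' x).hasDerivAt.add ((hy x).hasDerivAt.const_mul (k * l)))) ?_
      ring
    · linear_combination exp (k * l * x) * hode x hx
  · rintro ⟨n, hn, rfl⟩
    have hE (x : ℝ) := hasDerivAt_cexp_mul_ofReal (-k * n) x
    have hd : deriv (fun t : ℝ => exp (-k * n * t) * sin (n * t)) =
        fun t : ℝ => exp (-k * n * t) * (n * cos (n * t) - k * n * sin (n * t)) := by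
      ext x
      refine HasDerivAt.deriv ?_
      refine HasDerivAt.congr_deriv ((hE x).fun_mul (hasDerivAt_csin_mul_ofReal n x)) ?_
      ring
    have h2 (x : ℝ) : HasDerivAt
        (fun t : ℝ => exp (-k * n * t) * (n * cos (n * t) - k * n * sin (n * t)))
        (exp (-k * n * x) * ((k ^ 2 - 1) * n ^ 2 * sin (n * x) - 2 * k * n ^ 2 * cos (n * x)))
        x := by
      refine HasDerivAt.congr_deriv ((hE x).fun_mul
        (((hasDerivAt_ccos_mul_ofReal n x).const_mul (n : ℂ)).sub
        ((hasDerivAt_csin_mul_ofReal n x).const_mul (k * n)))) ?_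
      ring
    refine ⟨fun t => exp (-k * n * t) * sin (n * t),
      fun x => ((hE x).fun_mul (hasDerivAt_csin_mul_ofReal n x)).differentiableAt,
      ?_, fun x _ => ?_, ?_, by simp, ?_⟩
    · rw [hd]
      exact fun x => (h2 x).differentiableAt
    · rw [hd, (h2 x).deriv]
      ring
    · have hnR : (0 : ℝ) < |(n : ℝ)| := by simpa using hn
      have hn1 : (1 : ℝ) ≤ |(n : ℝ)| := by exact_mod_cast Int.one_le_abs hn
      have hnC : (n : ℂ) ≠ 0 := by exact_mod_cast hn
      refine ⟨Real.pi / 2 / |(n : ℝ)|, ⟨by positivity, ?_⟩, mul_ne_zero (exp_ne_zero _) ?_⟩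
      · rw [div_le_iff₀ hnR]
        nlinarith [Real.pi_pos]
      · rcases abs_choice (n : ℝ) with h | h <;> rw [h] <;> push_cast
        · rw [mul_div_cancel₀ _ hnC, sin_pi_div_two]
          exact one_ne_zero
        · rw [div_neg, mul_neg, mul_div_cancel₀ _ hnC, sin_neg, sin_pi_div_two]
          exact neg_ne_zero.2 one_ne_zero
    · simp [sin_int_mul_pi]


/-- The two Dirichlet problems, for the different equations
`y'' + 2λy' + 2λ²y = 0` and `y'' + 4λy' + 5λ²y = 0`, have exactly the same
eigenvalues, namely the nonzero integers: one cannot simultaneously recover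
the equation coefficients and the boundary condition coefficients from the
spectrum. -/
theorem same_spectrum_different_equations (l : ℂ) :
    (IsEigA13 l ↔ IsEigB13 l) ∧
      (IsEigA13 l ↔ ∃ n : ℤ, n ≠ 0 ∧ l = (n : ℂ)) := by
  have hA : IsEigA13 l ↔ ∃ n : ℤ, n ≠ 0 ∧ l = (n : ℂ) := by
    rw [← dirichlet_eigenvalue_iff 1 l, IsEigA13]
    norm_num
  have hB : IsEigB13 l ↔ ∃ n : ℤ, n ≠ 0 ∧ l = (n : ℂ) := by
    rw [← dirichlet_eigenvalue_iff 2 l, IsEigB13]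
    norm_num
  exact ⟨hA.trans hB.symm, hA⟩
end
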